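/- With the setup in the context, assume ω_j(A) < n for every j = 1, …, n−s, let ψ : [0,∞) → [0,∞) be non-increasing with ψ(x) ≤ 1/x for all x > 0, and let ξ ∈ (0,1). Let β ∈ (0, 1/(2(n+1))) and K_0 > 0 be such that |Ã_t| ≤ K_0 κ^{1/(s(n+1))} 2^{−((1/(2(n+1)) − β)/s) t} |U| for all t ∈ ℤ_{≥0}, and set K_1 := Σ_{t=0}^∞ 2^{−((1/(2(n+1)) − β)/s) t}. If 0 < κ < min{1, r/(2^{n−3/2}√(ns)), (ξ/(2K_0K_1))^{s(n+1)}}, then |⋃_{q ∈ ℤ^n∖{0}} L_small(q)| ≤ Σ_{t=0}^∞ |A_t| ≤ K_0 K_1 κ^{1/(s(n+1))} |U| < (ξ/2)|U|. -/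

import Mathlib

open MeasureTheory Metric Set
open scoped BigOperators ENNReal

noncomputable section

/-- `x̃ = (1, x)` -/
def tilde {s : ℕ} (x : Fin s → ℝ) : Fin (s + 1) → ℝ := Fin.cons 1 x

/-- The parametrization `x ↦ (x, x̃A)` of the affine subspace. -/
def phiA {s m : ℕ} (A : Matrix (Fin (s + 1)) (Fin m) ℝ) (x : Fin s → ℝ) :
    Fin (s + m) → ℝ :=
  Fin.append x (Matrix.vecMul (tilde x) A)

/-- `(x, x̃A) · q + p`. -/
def dotA {s m : ℕ} (A : Matrix (Fin (s + 1)) (Fin m) ℝ) (x : Fin s → ℝ)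
    (q : Fin (s + m) → ℤ) : ℝ :=
  ∑ j, phiA A x j * (q j : ℝ)

/-- The gradient `[Id_s A'] q` of `x ↦ (x, x̃A)·q`. -/
def gradA {s m : ℕ} (A : Matrix (Fin (s + 1)) (Fin m) ℝ) (q : Fin (s + m) → ℤ) :
    Fin s → ℝ :=
  fun i => (q (Fin.castAdd m i) : ℝ) + ∑ j, A i.succ j * (q (Fin.natAdd s j) : ℝ)

/-- Coordinate `⟨e_i ∧ e_J, w⟩` of the map `c` (zero unless `J ⊆ {1,…,n}` and `i ∉ J`). -/
def cMap {n : ℕ} (w : Finset (Fin (n + 1)) → ℝ) (i : Fin (n + 1))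
    (J : Finset (Fin (n + 1))) : ℝ :=
  if (0 : Fin (n + 1)) ∈ J ∨ i ∈ J then 0
  else (-1 : ℝ) ^ (J.filter (· < i)).card * w (insert i J)

/-- The matrix `R_A = (Id_{s+1} | A)`. -/
def RA {s m : ℕ} (A : Matrix (Fin (s + 1)) (Fin m) ℝ) :
    Matrix (Fin (s + 1)) (Fin (s + m + 1)) ℝ :=
  fun a i =>
    if h : (i : ℕ) < s + 1 then (if (i : ℕ) = (a : ℕ) then 1 else 0)
    else A a ⟨(i : ℕ) - (s + 1), by omega⟩

/-- Coordinates of `R_A c(w)`. -/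
def RAc {s m : ℕ} (A : Matrix (Fin (s + 1)) (Fin m) ℝ)
    (w : Finset (Fin (s + m + 1)) → ℝ) (a : Fin (s + 1)) (J : Finset (Fin (s + m + 1))) : ℝ :=
  ∑ i, RA A a i * cMap w i J

/-- Euclidean norm of `R_A c(w)`. -/
def RAcNorm {s m : ℕ} (A : Matrix (Fin (s + 1)) (Fin m) ℝ)
    (w : Finset (Fin (s + m + 1)) → ℝ) : ℝ :=
  Real.sqrt (∑ a, ∑ J, (RAc A w a J) ^ 2)

/-- Euclidean norm of the projection `π_•(w)` onto `⋀(W_{s+1→n})`. -/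
def pibullNorm (s : ℕ) {n : ℕ} (w : Finset (Fin (n + 1)) → ℝ) : ℝ :=
  Real.sqrt (∑ S : Finset (Fin (n + 1)),
    if ∀ i ∈ S, s < (i : ℕ) then (w S) ^ 2 else 0)

/-- Euclidean norm of an exterior vector in coordinates. -/
def extNorm {N : ℕ} (w : Finset (Fin N) → ℝ) : ℝ :=
  Real.sqrt (∑ S : Finset (Fin N), (w S) ^ 2)

/-- Euclidean norm of the projection `π(w)` onto `⋀(W_{1→n})`. -/
def piNorm {n : ℕ} (w : Finset (Fin (n + 1)) → ℝ) : ℝ :=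
  Real.sqrt (∑ S : Finset (Fin (n + 1)),
    if (0 : Fin (n + 1)) ∉ S then (w S) ^ 2 else 0)

/-- `w` has pure degree `k`. -/
def ExtDeg {N : ℕ} (k : ℕ) (w : Finset (Fin N) → ℝ) : Prop :=
  ∀ S, S.card ≠ k → w S = 0

/-- The set of exponents `v` appearing in the definition of `ω_j(A)`. -/
def expSet (s m : ℕ) (A : Matrix (Fin (s + 1)) (Fin m) ℝ) (j : ℕ) : Set ℝ :=
  {v | 0 < v ∧ ∀ M : ℝ, ∃ w : Finset (Fin (s + m + 1)) → ℤ,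
    (∀ S, S.card ≠ j → w S = 0) ∧
    M < pibullNorm s (fun S => (w S : ℝ)) ∧
    RAcNorm A (fun S => (w S : ℝ)) <
      pibullNorm s (fun S => (w S : ℝ)) ^ (-(v + 1 - j) / j)}

/-- `ω_j(A) < n` for all `j = 1, …, n − s`  (here `n = s + m`). -/
def DiophCond (s m : ℕ) (A : Matrix (Fin (s + 1)) (Fin m) ℝ) : Prop :=
  ∀ j : ℕ, 1 ≤ j → j ≤ m → ∃ v : ℝ, v < (s + m : ℕ) ∧ ∀ u ∈ expSet s m A j, u ≤ v

/-- Action of a matrix on exterior coordinates (compound matrix action). -/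
def extAction {N : ℕ} (M : Matrix (Fin N) (Fin N) ℝ) (w : Finset (Fin N) → ℝ) :
    Finset (Fin N) → ℝ :=
  fun S => ∑ T : Finset (Fin N),
    if h : T.card = S.card then
      (Matrix.of fun a b : Fin S.card =>
          M (S.orderEmbOfFin rfl a) (T.orderEmbOfFin h b)).det * w T
    else 0

/-- The wedge `v_1 ∧ ⋯ ∧ v_k` of vectors, in coordinates. -/
def wedgeOf {N k : ℕ} (v : Fin k → (Fin N → ℝ)) : Finset (Fin N) → ℝ :=
  fun S =>
    if h : S.card = k then
      (Matrix.of fun a b : Fin k => v a (S.orderEmbOfFin h b)).det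
    else 0

/-- Sign for the wedge product of basis monomials. -/
def wedgeSign {N : ℕ} (T T' : Finset (Fin N)) : ℝ :=
  (-1) ^ (∑ a ∈ T, (T'.filter (· < a)).card)

/-- The wedge (exterior) product in coordinates. -/
def wedgeMul {N : ℕ} (u w : Finset (Fin N) → ℝ) : Finset (Fin N) → ℝ :=
  fun S => ∑ T ∈ S.powerset, wedgeSign T (S \ T) * u T * w (S \ T)

/-- The unipotent matrix `u_x` on `ℝ^{1+s+n}`, `n = s+m`, with block rows
`(1, 0, x, x̃A)`, `(0, I_s, I_s, A')`, `(0, 0, I_n)`. -/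
def uMat {s m : ℕ} (A : Matrix (Fin (s + 1)) (Fin m) ℝ) (x : Fin s → ℝ) :
    Matrix (Fin (1 + s + (s + m))) (Fin (1 + s + (s + m))) ℝ :=
  fun i j =>
    if (i : ℕ) = 0 then
      if (j : ℕ) = 0 then 1
      else if h1 : (j : ℕ) < 1 + s then 0
      else if h2 : (j : ℕ) < 1 + s + s then x ⟨(j : ℕ) - (1 + s), by omega⟩
      else ∑ a, tilde x a * A a ⟨(j : ℕ) - (1 + s + s), by have := j.isLt; omega⟩
    else if hi : (i : ℕ) < 1 + s then
      if (j : ℕ) = 0 then 0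
      else if h1 : (j : ℕ) < 1 + s then (if (j : ℕ) = (i : ℕ) then 1 else 0)
      else if h2 : (j : ℕ) < 1 + s + s then (if (j : ℕ) = (i : ℕ) + s then 1 else 0)
      else A ⟨(i : ℕ), by omega⟩ ⟨(j : ℕ) - (1 + s + s), by have := j.isLt; omega⟩
    else if j = i then 1 else 0

/-- The diagonal matrix `g_t = diag(ε/δ, ε/K, …, ε/K, ε/T, …, ε/T)` on `ℝ^{1+s+n}`. -/
def gMat (s m : ℕ) (δ K T ε : ℝ) :
    Matrix (Fin (1 + s + (s + m))) (Fin (1 + s + (s + m))) ℝ :=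
  Matrix.diagonal fun i =>
    if (i : ℕ) = 0 then ε / δ else if (i : ℕ) < 1 + s then ε / K else ε / T

/-- The vector `(p, 0, …, 0, q) ∈ Λ ⊂ ℤ^{1+s+n}`. -/
def lamVec (s m : ℕ) (p : ℤ) (q : Fin (s + m) → ℤ) : Fin (1 + s + (s + m)) → ℝ :=
  fun i =>
    if (i : ℕ) = 0 then (p : ℝ)
    else if h : (i : ℕ) < 1 + s then 0
    else (q ⟨(i : ℕ) - (1 + s), by have := i.isLt; omega⟩ : ℝ)

/-- The matrix `ũ_x` on `ℝ^{n+1}`, with block rows `(1, x, x̃A)` and `(0, I_n)`. -/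
def utMat {s m : ℕ} (A : Matrix (Fin (s + 1)) (Fin m) ℝ) (x : Fin s → ℝ) :
    Matrix (Fin (s + m + 1)) (Fin (s + m + 1)) ℝ :=
  fun i j =>
    if (i : ℕ) = 0 then
      if h : (j : ℕ) = 0 then 1
      else phiA A x ⟨(j : ℕ) - 1, by have := j.isLt; omega⟩
    else if j = i then 1 else 0

/-- The diagonal matrix `g̃_t = diag(ε/δ, ε/T, …, ε/T)` on `ℝ^{n+1}`. -/
def gtMat (s m : ℕ) (δ T ε : ℝ) : Matrix (Fin (s + m + 1)) (Fin (s + m + 1)) ℝ :=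
  Matrix.diagonal fun i => if (i : ℕ) = 0 then ε / δ else ε / T

/-- The function `ν(w) = ‖π_*(w)‖`: the euclidean norm of the part of `w` involving at most
one of the starred basis vectors `e_{*1}, …, e_{*s}` (indices `1, …, s` of `ℝ^{1+s+n}`). -/
def nuFun (s m : ℕ) (w : Finset (Fin (1 + s + (s + m))) → ℝ) : ℝ :=
  Real.sqrt (∑ S : Finset (Fin (1 + s + (s + m))),
    if (S.filter fun i : Fin (1 + s + (s + m)) => 1 ≤ (i : ℕ) ∧ (i : ℕ) < 1 + s).card ≤ 1
    then (w S) ^ 2 else 0)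

/-- `δ := κ/2^{nt}`. -/
def deltaP (s m : ℕ) (κ : ℝ) (t : ℕ) : ℝ := κ / 2 ^ ((s + m) * t)

/-- `K := √(ns/(2r²))·2^{t/2}`. -/
def KofT (s m : ℕ) (r : ℝ) (t : ℕ) : ℝ :=
  Real.sqrt (((s + m : ℕ) : ℝ) * s / (2 * r ^ 2)) * 2 ^ ((t : ℝ) / 2)

/-- `T := 2^{t+1}`. -/
def TofT (t : ℕ) : ℝ := 2 ^ (t + 1)

/-- `ε' := (δKT^{n−1})^{1/(n+1)}`. -/
def epsP' (s m : ℕ) (κ r : ℝ) (t : ℕ) : ℝ :=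
  (deltaP s m κ t * KofT s m r t * TofT t ^ (s + m - 1)) ^ (1 / ((s + m : ℕ) + 1 : ℝ))

/-- `ε := 2^{βt} ε'`. -/
def epsP (s m : ℕ) (κ r β : ℝ) (t : ℕ) : ℝ :=
  (2 : ℝ) ^ (β * t) * epsP' s m κ r t

/-- `‖ỹ c(w)‖` where `ỹ = (1, x, x̃A) = x̃ R_A`. -/
def ycNorm {s m : ℕ} (A : Matrix (Fin (s + 1)) (Fin m) ℝ) (x : Fin s → ℝ)
    (w : Finset (Fin (s + m + 1)) → ℝ) : ℝ :=
  Real.sqrt (∑ J : Finset (Fin (s + m + 1)),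
    (∑ i, (Fin.cons (1 : ℝ) (phiA A x) : Fin (s + m + 1) → ℝ) i * cMap w i J) ^ 2)

/-- A function is `(C, α)`-good on `V ⊆ ℝ^s`. -/
def IsGood (s : ℕ) (C α : ℝ) (f : EuclideanSpace ℝ (Fin s) → ℝ)
    (V : Set (EuclideanSpace ℝ (Fin s))) : Prop :=
  ∀ (y₀ : EuclideanSpace ℝ (Fin s)) (r : ℝ), 0 < r → ball y₀ r ⊆ V →
    ∀ ε : ℝ, 0 < ε →
      volume {x ∈ ball y₀ r | |f x| < ε} ≤
        ENNReal.ofReal (C * (ε / sSup ((fun y => |f y|) '' ball y₀ r)) ^ α) *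
          volume (ball y₀ r)

/-- `V_s`: the volume of the `s`-dimensional euclidean unit ball. -/
def Vball (s : ℕ) : ℝ := (volume (ball (0 : EuclideanSpace ℝ (Fin s)) 1)).toReal

/-- `N_s`: the Besicovitch covering constant of `ℝ^s`. -/
def Nbes (s : ℕ) : ℕ := Besicovitch.multiplicity (EuclideanSpace ℝ (Fin s))

/-- `K_s := 4^{2s+1} s^{s/2} N_s / V_s`. -/
def Kcst (s : ℕ) : ℝ :=
  4 ^ (2 * s + 1) * (s : ℝ) ^ ((s : ℝ) / 2) * (Nbes s : ℝ) / Vball s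

/-- `Γ` is a primitive subgroup of `Λ`: `Γ ≤ Λ` and `Γ_ℝ ∩ Λ = Γ`. -/
def IsPrimitiveIn {d : ℕ} (Λ Γ : Submodule ℤ (Fin d → ℝ)) : Prop :=
  Γ ≤ Λ ∧
    (Submodule.span ℝ (Γ : Set (Fin d → ℝ))).restrictScalars ℤ ⊓ Λ = Γ

/-- `u` is a basis of the discrete subgroup `Γ` (so `u₁ ∧ ⋯ ∧ u_j` represents `Γ`). -/
def Represents {d j : ℕ} (u : Fin j → (Fin d → ℝ)) (Γ : Submodule ℤ (Fin d → ℝ)) : Prop :=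
  LinearIndependent ℝ u ∧ Submodule.span ℤ (Set.range u) = Γ

/-- `w = v₁ ∧ ⋯ ∧ v_k` represents the nonzero primitive rank-`k` subgroup of `ℤ^N`
generated by `v₁, …, v_k`. -/
def RepresentsPrimInt {N k : ℕ} (v : Fin k → (Fin N → ℤ)) (w : Finset (Fin N) → ℝ) : Prop :=
  LinearIndependent ℝ (fun a => fun i => ((v a i : ℝ))) ∧
  (∀ z : Fin N → ℤ,
      ((fun i => (z i : ℝ)) ∈
        Submodule.span ℝ (Set.range fun a => fun i => ((v a i : ℝ)))) →
      z ∈ Submodule.span ℤ (Set.range v)) ∧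
  w = wedgeOf fun a => fun i => ((v a i : ℝ))
theorem lamVec_natAdd {s m : ℕ} (p : ℤ) (q : Fin (s + m) → ℤ) (k : Fin (s + m)) :
    lamVec s m p q (Fin.natAdd (1 + s) k) = q k := by
  simp [lamVec]

theorem lamVec_castAdd_natAdd {s m : ℕ} (p : ℤ) (q : Fin (s + m) → ℤ) (k : Fin s) :
    lamVec s m p q (Fin.castAdd (s + m) (Fin.natAdd 1 k)) = 0 := by
  simp [lamVec]

theorem lamVec_castAdd_castAdd {s m : ℕ} (p : ℤ) (q : Fin (s + m) → ℤ) (k : Fin 1) :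
    lamVec s m p q (Fin.castAdd (s + m) (Fin.castAdd s k)) = p := by
  simp [lamVec]

/-- The first coordinate of `u_x λ` is `p + (x, x̃A)·q`. -/
theorem uMat_mulVec_lamVec_zero {s m : ℕ} (A : Matrix (Fin (s + 1)) (Fin m) ℝ)
    (x : Fin s → ℝ) (p : ℤ) (q : Fin (s + m) → ℤ) (i : Fin (1 + s + (s + m)))
    (hi : (i : ℕ) = 0) :
    (uMat A x).mulVec (lamVec s m p q) i = p + dotA A x q := by
  have h₁ : ∀ k : Fin s, uMat A x i (Fin.natAdd (1 + s) (Fin.castAdd m k)) = x k := fun k => by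
    simp [uMat, hi]
  have h₂ : ∀ k : Fin m, uMat A x i (Fin.natAdd (1 + s) (Fin.natAdd s k)) =
      Matrix.vecMul (tilde x) A k := fun k => by
    simp [uMat, hi, ← add_assoc, Matrix.vecMul, dotProduct]
    omega
  have h₀ : ∀ k : Fin 1, uMat A x i (Fin.castAdd (s + m) (Fin.castAdd s k)) = 1 := fun k => by
    simp [uMat, hi]
  simp only [Matrix.mulVec, dotProduct, Fin.sum_univ_add, lamVec_natAdd, lamVec_castAdd_natAdd,
    lamVec_castAdd_castAdd, h₀, h₁, h₂, dotA, phiA, Fin.append_left, Fin.append_right]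
  simp

/-- The starred coordinates of `u_x λ` form `[Id_s A'] q`. -/
theorem uMat_mulVec_lamVec_castAdd_natAdd {s m : ℕ} (A : Matrix (Fin (s + 1)) (Fin m) ℝ)
    (x : Fin s → ℝ) (p : ℤ) (q : Fin (s + m) → ℤ) (k : Fin s) :
    (uMat A x).mulVec (lamVec s m p q) (Fin.castAdd (s + m) (Fin.natAdd 1 k)) =
      gradA A q k := by
  have h₀ : ∀ l : Fin 1, uMat A x (Fin.castAdd (s + m) (Fin.natAdd 1 k))
      (Fin.castAdd (s + m) (Fin.castAdd s l)) = 0 := fun l => by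
    simp [uMat]
  have h₁ : ∀ l : Fin s, uMat A x (Fin.castAdd (s + m) (Fin.natAdd 1 k))
      (Fin.natAdd (1 + s) (Fin.castAdd m l)) = if l = k then 1 else 0 := fun l => by
    have hk : (1 + s + (l : ℕ) = 1 + (k : ℕ) + s) ↔ l = k := by
      rw [Fin.ext_iff]
      omega
    simp [uMat, hk]
  have h₂ : ∀ l : Fin m, uMat A x (Fin.castAdd (s + m) (Fin.natAdd 1 k))
      (Fin.natAdd (1 + s) (Fin.natAdd s l)) = A k.succ l := fun l => by
    have hk : ∀ h : 1 + (k : ℕ) < s + 1, (⟨1 + (k : ℕ), h⟩ : Fin (s + 1)) = k.succ := fun h => by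
      ext
      simp [add_comm]
    simp [uMat, ← add_assoc, hk]
    omega
  simp only [Matrix.mulVec, dotProduct, Fin.sum_univ_add, lamVec_natAdd, lamVec_castAdd_natAdd,
    lamVec_castAdd_castAdd, h₀, h₁, h₂, gradA]
  simp

/-- The last coordinates of `u_x λ` form `q`. -/
theorem uMat_mulVec_lamVec_natAdd {s m : ℕ} (A : Matrix (Fin (s + 1)) (Fin m) ℝ)
    (x : Fin s → ℝ) (p : ℤ) (q : Fin (s + m) → ℤ) (k : Fin (s + m)) :
    (uMat A x).mulVec (lamVec s m p q) (Fin.natAdd (1 + s) k) = q k := by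
  have h : ∀ j, uMat A x (Fin.natAdd (1 + s) k) j =
      if j = Fin.natAdd (1 + s) k then 1 else 0 := fun j => by
    simp [uMat]
  simp only [Matrix.mulVec, dotProduct, h, ite_mul, one_mul, zero_mul, Finset.sum_ite_eq',
    Finset.mem_univ, if_true, lamVec_natAdd]

/-- A vector with `|p + (x, x̃A)·q| < δ`, `‖[Id_s A'] q‖ < K` and `‖q‖ < T` is short after
applying `g_t u_x`. -/
theorem norm_gMat_uMat_mulVec_lt {s m : ℕ} (A : Matrix (Fin (s + 1)) (Fin m) ℝ)
    (x : Fin s → ℝ) (p : ℤ) (q : Fin (s + m) → ℤ) {δ K T ε : ℝ}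
    (hδ : 0 < δ) (hK : 0 < K) (hT : 0 < T) (hε : 0 < ε)
    (h₁ : |(p : ℝ) + dotA A x q| < δ) (h₂ : ‖gradA A q‖ < K) (h₃ : ‖q‖ < T) :
    ‖(gMat s m δ K T ε * uMat A x).mulVec (lamVec s m p q)‖ < ε := by
  have scale : ∀ {c y : ℝ}, 0 < c → |y| < c → ‖ε / c * y‖ < ε := fun {c y} hc hy => by
    rw [Real.norm_eq_abs, abs_mul, abs_of_pos (div_pos hε hc), div_mul_eq_mul_div,
      div_lt_iff₀ hc]
    gcongr
  rw [← Matrix.mulVec_mulVec, pi_norm_lt_iff hε]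
  intro i
  rw [gMat, Matrix.mulVec_diagonal]
  by_cases hi : (i : ℕ) = 0
  · rw [if_pos hi, uMat_mulVec_lamVec_zero A x p q i hi]
    exact scale hδ h₁
  rw [if_neg hi]
  by_cases hi' : (i : ℕ) < 1 + s
  · obtain ⟨k, rfl⟩ : ∃ k : Fin s, i = Fin.castAdd (s + m) (Fin.natAdd 1 k) :=
      ⟨⟨i - 1, by omega⟩, by ext; simp; omega⟩
    rw [if_pos hi', uMat_mulVec_lamVec_castAdd_natAdd]
    exact scale hK ((norm_le_pi_norm (gradA A q) k).trans_lt h₂)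
  · obtain ⟨k, rfl⟩ : ∃ k : Fin (s + m), i = Fin.natAdd (1 + s) k :=
      ⟨⟨i - (1 + s), by omega⟩, by ext; simp; omega⟩
    rw [if_neg hi', uMat_mulVec_lamVec_natAdd]
    refine scale hT ?_
    rw [← Int.norm_eq_abs]
    exact (norm_le_pi_norm q k).trans_lt h₃

theorem KofT_pos {s m : ℕ} (hs : 1 ≤ s) {r : ℝ} (hr : 0 < r) (t : ℕ) : 0 < KofT s m r t := by
  have : (0 : ℝ) < s := by exact_mod_cast hs
  unfold KofT
  push_cast
  positivity

theorem sqrt_div_two_mul_le_KofT {s m : ℕ} {r : ℝ} (hr : 0 < r) (t : ℕ) {y : ℝ}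
    (hy : y ≤ TofT t) :
    Real.sqrt ((((s + m) * s : ℕ) : ℝ) * y) / (2 * r) ≤ KofT s m r t := by
  have h2 : ((2 : ℝ) ^ ((t : ℝ) / 2)) ^ 2 = 2 ^ t := by
    rw [← Real.rpow_natCast, ← Real.rpow_mul (by norm_num), ← Real.rpow_natCast]
    congr 1
    push_cast
    ring
  rw [div_le_iff₀ (by positivity)]
  apply Real.sqrt_le_iff.mpr
  refine ⟨by unfold KofT; positivity, ?_⟩
  have hsq : (KofT s m r t * (2 * r)) ^ 2 = (((s + m) * s : ℕ) : ℝ) * TofT t := by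
    rw [KofT, mul_pow, mul_pow, Real.sq_sqrt (by positivity), h2, TofT]
    push_cast
    field_simp
    ring
  rw [hsq]
  gcongr

theorem one_le_norm_of_ne_zero {ι : Type*} [Fintype ι] {q : ι → ℤ} (hq : q ≠ 0) : 1 ≤ ‖q‖ := by
  obtain ⟨i, hi⟩ := Function.ne_iff.mp hq
  refine le_trans ?_ (norm_le_pi_norm q i)
  rw [Int.norm_eq_abs]
  exact_mod_cast Int.one_le_abs hi

theorem mul_apply_norm_pow_le_deltaP {s m : ℕ} {κ : ℝ} (hκ : 0 ≤ κ) {ψ : ℝ → ℝ}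
    (hψ : ∀ x : ℝ, 0 < x → ψ x ≤ 1 / x) {t : ℕ} {y : ℝ} (hy : 2 ^ t ≤ y) :
    κ * ψ (y ^ (s + m)) ≤ deltaP s m κ t := by
  have hy0 : 0 < y := lt_of_lt_of_le (by positivity) hy
  have hle : (2 : ℝ) ^ ((s + m) * t) ≤ y ^ (s + m) := by
    rw [mul_comm, pow_mul]
    gcongr
  rw [deltaP, ← mul_one_div]
  refine mul_le_mul_of_nonneg_left ((hψ _ (by positivity)).trans ?_) hκ
  exact one_div_le_one_div_of_le (by positivity) hle

theorem summable_two_rpow_neg_mul {c : ℝ} (hc : 0 < c) :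
    Summable fun t : ℕ => (2 : ℝ) ^ (-(c * t)) := by
  have h : (fun t : ℕ => (2 : ℝ) ^ (-(c * t))) = fun t : ℕ => ((2 : ℝ) ^ (-c)) ^ t := by
    funext t
    rw [← Real.rpow_natCast, ← Real.rpow_mul (by norm_num), neg_mul]
  rw [h]
  exact summable_geometric_of_lt_one (by positivity)
    (Real.rpow_lt_one_of_one_lt_of_neg (by norm_num) (by linarith))

/-- Conclusion of the small-gradient case: given the measure bound for the sets `Ã_t`,
for `κ` small enough one gets `|⋃ L_small(q)| ≤ Σ_t |A_t| ≤ K₀K₁ κ^{1/(s(n+1))}|U| < (ξ/2)|U|`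
(here `n = s + m`). -/
theorem small_gradient_conclusion (s m : ℕ) (hs : 1 ≤ s) (hm : 1 ≤ m)
    (A : Matrix (Fin (s + 1)) (Fin m) ℝ) (hA : DiophCond s m A)
    (x₀ : EuclideanSpace ℝ (Fin s)) (r : ℝ) (hr : 0 < r)
    (ψ : ℝ → ℝ) (hmono : AntitoneOn ψ (Ici 0)) (hnn : ∀ x ∈ Ici (0 : ℝ), 0 ≤ ψ x)
    (hψ : ∀ x : ℝ, 0 < x → ψ x ≤ 1 / x)
    (ξ : ℝ) (hξ : ξ ∈ Ioo (0 : ℝ) 1)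
    (β : ℝ) (hβ : β ∈ Ioo (0 : ℝ) (1 / (2 * ((s + m : ℕ) + 1 : ℝ))))
    (K0 : ℝ) (hK0 : 0 < K0) (κ : ℝ)
    (hbound : ∀ t : ℕ,
      volume {x ∈ ball x₀ r | ∃ (p : ℤ) (q : Fin (s + m) → ℤ), ¬(p = 0 ∧ q = 0) ∧
          ‖(gMat s m (deltaP s m κ t) (KofT s m r t) (TofT t) (epsP s m κ r β t) *
              uMat A (fun i => x i)).mulVec (lamVec s m p q)‖ < epsP s m κ r β t} ≤
        ENNReal.ofReal (K0 * κ ^ (1 / ((s : ℝ) * ((s + m : ℕ) + 1 : ℝ))) *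
            (2 : ℝ) ^ (-(((1 / (2 * ((s + m : ℕ) + 1 : ℝ)) - β) / s) * t))) *
          volume (ball x₀ r))
    (K1 : ℝ)
    (hK1 : K1 = ∑' t : ℕ, (2 : ℝ) ^ (-(((1 / (2 * ((s + m : ℕ) + 1 : ℝ)) - β) / s) * t)))
    (hκ0 : 0 < κ)
    (hκ : κ < min (min 1 (r / ((2 : ℝ) ^ ((s + m : ℝ) - 3 / 2) *
        Real.sqrt (((s + m) * s : ℕ)))))
      ((ξ / (2 * K0 * K1)) ^ (s * (s + m + 1)))) :
    volume (⋃ q : {q : Fin (s + m) → ℤ // q ≠ 0},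
        {x ∈ ball x₀ r |
          (∃ p : ℤ, |(p : ℝ) + dotA A (fun i => x i) q.1| < κ * ψ (‖q.1‖ ^ (s + m))) ∧
          ‖gradA A q.1‖ < Real.sqrt ((((s + m) * s : ℕ) : ℝ) * ‖q.1‖) / (2 * r)}) ≤
      (∑' t : ℕ, volume {x ∈ ball x₀ r | ∃ (p : ℤ) (q : Fin (s + m) → ℤ),
          |(p : ℝ) + dotA A (fun i => x i) q| < deltaP s m κ t ∧
          ‖gradA A q‖ < KofT s m r t ∧
          (2 : ℝ) ^ t ≤ ‖q‖ ∧ ‖q‖ < TofT t}) ∧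
    (∑' t : ℕ, volume {x ∈ ball x₀ r | ∃ (p : ℤ) (q : Fin (s + m) → ℤ),
          |(p : ℝ) + dotA A (fun i => x i) q| < deltaP s m κ t ∧
          ‖gradA A q‖ < KofT s m r t ∧
          (2 : ℝ) ^ t ≤ ‖q‖ ∧ ‖q‖ < TofT t}) ≤
      ENNReal.ofReal (K0 * K1 * κ ^ (1 / ((s : ℝ) * ((s + m : ℕ) + 1 : ℝ)))) *
        volume (ball x₀ r) ∧
    ENNReal.ofReal (K0 * K1 * κ ^ (1 / ((s : ℝ) * ((s + m : ℕ) + 1 : ℝ)))) *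
        volume (ball x₀ r) <
      ENNReal.ofReal (ξ / 2) * volume (ball x₀ r) := by
  have hs0 : (0 : ℝ) < s := by exact_mod_cast hs
  set c : ℝ := (1 / (2 * ((s + m : ℕ) + 1 : ℝ)) - β) / s with hc_def
  have hc : 0 < c := div_pos (sub_pos.mpr hβ.2) hs0
  have hsum := summable_two_rpow_neg_mul hc
  have hK1pos : 0 < K1 := by
    rw [hK1]
    exact hsum.tsum_pos (fun t => by positivity) 0 (by positivity)
  have hball : 0 < volume (ball x₀ r) := measure_ball_pos _ _ hr
  refine ⟨?_, ?_, ?_⟩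
  · refine (measure_mono ?_).trans (measure_iUnion_le _)
    intro x hx
    obtain ⟨⟨q, hq⟩, hxr, ⟨p, hp⟩, hgrad⟩ := mem_iUnion.mp hx
    obtain ⟨t, ht, ht'⟩ :=
      exists_nat_pow_near (one_le_norm_of_ne_zero hq) (one_lt_two : (1 : ℝ) < 2)
    exact mem_iUnion.mpr ⟨t, hxr, p, q,
      hp.trans_le (mul_apply_norm_pow_le_deltaP hκ0.le hψ ht),
      hgrad.trans_le (sqrt_div_two_mul_le_KofT hr t ht'.le), ht, ht'⟩
  · calc
      _ ≤ ∑' t : ℕ, ENNReal.ofReal (K0 * κ ^ (1 / ((s : ℝ) * ((s + m : ℕ) + 1 : ℝ))) *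
            (2 : ℝ) ^ (-(c * t))) * volume (ball x₀ r) := by
        refine ENNReal.tsum_le_tsum fun t => (measure_mono ?_).trans (hbound t)
        rintro x ⟨hxr, p, q, hp, hgrad, hq, hq'⟩
        have hδ : 0 < deltaP s m κ t := by unfold deltaP; positivity
        have hK : 0 < KofT s m r t := KofT_pos hs hr t
        have hT : 0 < TofT t := by unfold TofT; positivity
        have hε : 0 < epsP s m κ r β t := by unfold epsP epsP'; positivity
        refine ⟨hxr, p, q, ?_, norm_gMat_uMat_mulVec_lt A _ p q hδ hK hT hε hp hgrad hq'⟩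
        rintro ⟨-, rfl⟩
        rw [norm_zero] at hq
        exact absurd hq (not_le.mpr (by positivity))
      _ = _ := by
        rw [ENNReal.tsum_mul_right,
          ← ENNReal.ofReal_tsum_of_nonneg (fun t => by positivity) (hsum.mul_left _),
          tsum_mul_left, ← hK1]
        congr 2
        ring
  · refine ENNReal.mul_lt_mul_left hball.ne' measure_ball_lt_top.ne ?_
    refine (ENNReal.ofReal_lt_ofReal_iff (by linarith [hξ.1])).mpr ?_
    have hlt := hκ.trans_le (min_le_right _ _)
    have hb : 0 < ξ / (2 * K0 * K1) := div_pos hξ.1 (by positivity)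
    have hroot := Real.rpow_lt_rpow hκ0.le hlt
      (show (0 : ℝ) < 1 / ((s : ℝ) * ((s + m : ℕ) + 1 : ℝ)) by positivity)
    have hcast : (1 / ((s : ℝ) * ((s + m : ℕ) + 1 : ℝ))) =
        ((s * (s + m + 1) : ℕ) : ℝ)⁻¹ := by
      push_cast
      rw [one_div]
    have hexp : s * (s + m + 1) ≠ 0 := by positivity
    rw [hcast, Real.pow_rpow_inv_natCast hb.le hexp, lt_div_iff₀ (by positivity)] at hroot
    rw [hcast]
    linarith

end
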